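/- Lemma 5.7 (Lipschitz constant of blow-up limits). Let U ⊆ ℝⁿ (n ≥ 1) be a bounded open set and let (u₁, u₂) be a pair of continuous real functions on the closure of U that is a viscosity solution of the system −Δ∞u₁ + u₁ − u₂ = 0, −Δ∞u₂ + u₂ − u₁ = 0 in U. Fix x₀ ∈ U and for r > 0 define v_i^r(x) := (u_i(x₀ + rx) − u_i(x₀))/r (defined for |x| < dist(x₀,∂U)/r). Suppose r_j → 0⁺ and v_i^{r_j} → v_i locally uniformly on ℝⁿ for i = 1, 2 (i.e., for every compact K ⊂ ℝⁿ, v_i^{r_j} is defined on K for all large j and converges to v_i uniformly on K). Then for each i ∈ {1,2}, v_i is Lipschitz on ℝⁿ with best Lipschitz constant equal to S_i⁺(x₀) := lim_{r→0⁺} S_i⁺(x₀,r); that is, |v_i(x) − v_i(y)| ≤ S_i⁺(x₀)|x − y| for all x, y ∈ ℝⁿ, and no constant smaller than S_i⁺(x₀) has this property unless v_i is constant with S_i⁺(x₀) = 0. -/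

import Mathlib

open Filter Metric Set Topology

noncomputable def secondDeriv {n : ℕ} (φ : EuclideanSpace ℝ (Fin n) → ℝ)
    (x v : EuclideanSpace ℝ (Fin n)) : ℝ :=
  iteratedFDeriv ℝ 2 φ x ![v, v]

open scoped Classical in
noncomputable def laplInfPlus {n : ℕ} (φ : EuclideanSpace ℝ (Fin n) → ℝ)
    (x : EuclideanSpace ℝ (Fin n)) : ℝ :=
  if gradient φ x = 0 then
    sSup {t : ℝ | ∃ v : EuclideanSpace ℝ (Fin n), ‖v‖ = 1 ∧ t = secondDeriv φ x v}
  else secondDeriv φ x (gradient φ x) / ‖gradient φ x‖ ^ 2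

open scoped Classical in
noncomputable def laplInfMinus {n : ℕ} (φ : EuclideanSpace ℝ (Fin n) → ℝ)
    (x : EuclideanSpace ℝ (Fin n)) : ℝ :=
  if gradient φ x = 0 then
    sInf {t : ℝ | ∃ v : EuclideanSpace ℝ (Fin n), ‖v‖ = 1 ∧ t = secondDeriv φ x v}
  else secondDeriv φ x (gradient φ x) / ‖gradient φ x‖ ^ 2

/-- One half of the subsolution condition: `-Δ∞⁺φ(x₀) + u(x₀) - v(x₀) ≤ 0` at
local maximum points of `u - φ`. -/
def SubPair {n : ℕ} (U : Set (EuclideanSpace ℝ (Fin n)))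
    (u v : EuclideanSpace ℝ (Fin n) → ℝ) : Prop :=
  ∀ φ : EuclideanSpace ℝ (Fin n) → ℝ, ContDiff ℝ 2 φ →
    ∀ x₀ ∈ U, IsLocalMaxOn (fun x => u x - φ x) U x₀ →
      -laplInfPlus φ x₀ + u x₀ - v x₀ ≤ 0

def SuperPair {n : ℕ} (U : Set (EuclideanSpace ℝ (Fin n)))
    (u v : EuclideanSpace ℝ (Fin n) → ℝ) : Prop :=
  ∀ φ : EuclideanSpace ℝ (Fin n) → ℝ, ContDiff ℝ 2 φ →
    ∀ x₀ ∈ U, IsLocalMinOn (fun x => u x - φ x) U x₀ →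
      0 ≤ -laplInfMinus φ x₀ + u x₀ - v x₀

/-- `(u₁, u₂)` is a viscosity subsolution of the system
`-Δ∞u₁ + u₁ - u₂ = 0`, `-Δ∞u₂ + u₂ - u₁ = 0` in `U`. -/
def IsSubsolution {n : ℕ} (U : Set (EuclideanSpace ℝ (Fin n)))
    (u₁ u₂ : EuclideanSpace ℝ (Fin n) → ℝ) : Prop :=
  UpperSemicontinuousOn u₁ U ∧ UpperSemicontinuousOn u₂ U ∧
    SubPair U u₁ u₂ ∧ SubPair U u₂ u₁

/-- `(u₁, u₂)` is a viscosity supersolution of the system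
`-Δ∞u₁ + u₁ - u₂ = 0`, `-Δ∞u₂ + u₂ - u₁ = 0` in `U`. -/
def IsSupersolution {n : ℕ} (U : Set (EuclideanSpace ℝ (Fin n)))
    (u₁ u₂ : EuclideanSpace ℝ (Fin n) → ℝ) : Prop :=
  LowerSemicontinuousOn u₁ U ∧ LowerSemicontinuousOn u₂ U ∧
    SuperPair U u₁ u₂ ∧ SuperPair U u₂ u₁

def IsSolution {n : ℕ} (U : Set (EuclideanSpace ℝ (Fin n)))
    (u₁ u₂ : EuclideanSpace ℝ (Fin n) → ℝ) : Prop :=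
  IsSubsolution U u₁ u₂ ∧ IsSupersolution U u₁ u₂

/-- First component of the generalized cone pair with vertex `x₀`. -/
noncomputable def cone₁ {n : ℕ} (x₀ : EuclideanSpace ℝ (Fin n)) (C₁ C₂ a b : ℝ)
    (x : EuclideanSpace ℝ (Fin n)) : ℝ :=
  C₁ * Real.exp (Real.sqrt 2 * ‖x - x₀‖) + C₂ * Real.exp (-(Real.sqrt 2 * ‖x - x₀‖)) +
    a * ‖x - x₀‖ + b

/-- Second component of the generalized cone pair with vertex `x₀`. -/
noncomputable def cone₂ {n : ℕ} (x₀ : EuclideanSpace ℝ (Fin n)) (C₁ C₂ a b : ℝ)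
    (x : EuclideanSpace ℝ (Fin n)) : ℝ :=
  -C₁ * Real.exp (Real.sqrt 2 * ‖x - x₀‖) - C₂ * Real.exp (-(Real.sqrt 2 * ‖x - x₀‖)) +
    a * ‖x - x₀‖ + b

noncomputable def sphMax {n : ℕ} (u : EuclideanSpace ℝ (Fin n) → ℝ)
    (x₀ : EuclideanSpace ℝ (Fin n)) (r : ℝ) : ℝ :=
  sSup (u '' sphere x₀ r)

noncomputable def sphMin {n : ℕ} (u : EuclideanSpace ℝ (Fin n) → ℝ)
    (x₀ : EuclideanSpace ℝ (Fin n)) (r : ℝ) : ℝ :=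
  sInf (u '' sphere x₀ r)

noncomputable def Splus {n : ℕ} (u : EuclideanSpace ℝ (Fin n) → ℝ)
    (x₀ : EuclideanSpace ℝ (Fin n)) (r : ℝ) : ℝ :=
  (sphMax u x₀ r - u x₀) / r

noncomputable def Sminus {n : ℕ} (u : EuclideanSpace ℝ (Fin n) → ℝ)
    (x₀ : EuclideanSpace ℝ (Fin n)) (r : ℝ) : ℝ :=
  (sphMin u x₀ r - u x₀) / r

theorem exists_contDiff_eventuallyEq_of_ne {E : Type*} [NormedAddCommGroup E]
    [InnerProductSpace ℝ E] [FiniteDimensional ℝ E] {f : E → ℝ} {x z : E} (hxz : z ≠ x)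
    (hf : ∀ y, y ≠ x → ContDiffAt ℝ 2 f y) :
    ∃ g : E → ℝ, ContDiff ℝ 2 g ∧ g =ᶠ[𝓝 z] f := by
  have hd : 0 < dist x z := dist_pos.2 hxz.symm
  let χ : ContDiffBump z := ⟨dist x z / 4, dist x z / 2, by linarith, by linarith⟩
  refine ⟨fun y => χ y * f y, contDiff_iff_contDiffAt.2 fun y => ?_, ?_⟩
  · by_cases hy : y = x
    · have h0 : (fun y => χ y * f y) =ᶠ[𝓝 y] fun _ => (0 : ℝ) := by
        have : ∀ᶠ y' in 𝓝 y, dist x z / 2 < dist y' z := by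
          refine (continuous_id.dist continuous_const).continuousAt.eventually_const_lt ?_
          simp only [id, hy]; linarith
        filter_upwards [this] with y' hy'
        rw [χ.zero_of_le_dist hy'.le, zero_mul]
      exact contDiffAt_const.congr_of_eventuallyEq h0
    · exact χ.contDiffAt.mul (hf y hy)
  · filter_upwards [χ.eventuallyEq_one] with y hy
    simp [hy]

/-- The Hessian quadratic form is the second derivative along a line. -/
theorem secondDeriv_eq_of_line {n : ℕ} {φ : EuclideanSpace ℝ (Fin n) → ℝ}
    (hφ : ContDiff ℝ 2 φ) {z v : EuclideanSpace ℝ (Fin n)} {h h' : ℝ → ℝ} {h'' : ℝ}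
    (hline : ∀ᶠ s in 𝓝 (0 : ℝ), φ (z + s • v) = h s)
    (hh : ∀ s, HasDerivAt h (h' s) s) (hh' : HasDerivAt h' h'' 0) :
    secondDeriv φ z v = h'' := by
  have hL : ∀ s : ℝ, HasDerivAt (fun s : ℝ => z + s • v) v s := fun s => by
    simpa using ((hasDerivAt_id s).smul_const v).const_add z
  have h1 : ∀ᶠ s in 𝓝 (0 : ℝ), fderiv ℝ φ (z + s • v) v = h' s := by
    filter_upwards [hline.eventually_nhds] with s hs
    have hd : HasFDerivAt φ (fderiv ℝ φ (z + s • v)) (z + s • v) :=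
      (hφ.differentiable (by norm_num) _).hasFDerivAt
    exact (hd.comp_hasDerivAt s (hL s)).unique
      ((hh s).congr_of_eventuallyEq hs)
  have hd2 : Differentiable ℝ (fderiv ℝ φ) :=
    (hφ.fderiv_right (m := 1) (by norm_num)).differentiable (by norm_num)
  have h2 : HasDerivAt (fun s : ℝ => fderiv ℝ φ (z + s • v) v)
      (fderiv ℝ (fderiv ℝ φ) z v v) 0 := by
    have hc : HasDerivAt (fun s : ℝ => fderiv ℝ φ (z + s • v)) (fderiv ℝ (fderiv ℝ φ) z v) 0 :=
      (hd2 z).hasFDerivAt.comp_hasDerivAt_of_eq 0 (hL 0) (by simp)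
    have he := (ContinuousLinearMap.apply ℝ ℝ v).hasFDerivAt.comp_hasDerivAt 0 hc
    exact he
  rw [secondDeriv, iteratedFDeriv_two_apply]
  exact h2.unique (hh'.congr_of_eventuallyEq h1)

theorem hasGradientAt_quadratic_cone {E : Type*} [NormedAddCommGroup E]
    [InnerProductSpace ℝ E] [CompleteSpace E] (x : E) {z : E} (hz : z ≠ x) (b A c : ℝ) :
    HasGradientAt (fun y => b + A * ‖y - x‖ - c / 2 * ‖y - x‖ ^ 2)
      ((A / ‖z - x‖ - c) • (z - x)) z := by
  have hpos : 0 < ‖z - x‖ := norm_pos_iff.2 (sub_ne_zero.2 hz)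
  have hsq : HasFDerivAt (fun y => ‖y - x‖ ^ 2) (2 • innerSL ℝ (z - x)) z := by
    simpa using ((hasFDerivAt_id z).sub_const x).norm_sq
  have hn : HasFDerivAt (fun y => ‖y - x‖)
      ((1 / (2 * ‖z - x‖)) • 2 • innerSL ℝ (z - x)) z := by
    have := hsq.sqrt (by positivity)
    simpa [Real.sqrt_sq] using this
  rw [hasGradientAt_iff_hasFDerivAt]
  refine (((hn.const_mul A).const_add b).sub (hsq.const_mul (c / 2))).congr_fderiv ?_
  ext w
  simp
  field_simp

theorem contDiffAt_quadratic_cone {E : Type*} [NormedAddCommGroup E]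
    [InnerProductSpace ℝ E] (x : E) {z : E} (hz : z ≠ x) (b A c : ℝ) :
    ContDiffAt ℝ 2 (fun y => b + A * ‖y - x‖ - c / 2 * ‖y - x‖ ^ 2) z := by
  have hn : ContDiffAt ℝ 2 (fun y => ‖y - x‖) z :=
    (contDiffAt_id.sub contDiffAt_const).norm ℝ (sub_ne_zero.2 hz)
  exact (contDiffAt_const.add (contDiffAt_const.mul hn)).sub (contDiffAt_const.mul (hn.pow 2))

/-- A smooth function that agrees with a quadratic cone near a noncritical point has infinity
Laplacian `-c` there. -/
theorem laplInfPlus_of_eventuallyEq_quadratic_cone {n : ℕ}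
    {φ : EuclideanSpace ℝ (Fin n) → ℝ} (hφ : ContDiff ℝ 2 φ)
    {x z : EuclideanSpace ℝ (Fin n)} (hz : z ≠ x) {b A c : ℝ}
    (hA : A - c * ‖z - x‖ ≠ 0)
    (heq : φ =ᶠ[𝓝 z] fun y => b + A * ‖y - x‖ - c / 2 * ‖y - x‖ ^ 2) :
    laplInfPlus φ z = -c := by
  have hpos : 0 < ‖z - x‖ := norm_pos_iff.2 (sub_ne_zero.2 hz)
  set k := A / ‖z - x‖ - c with hk
  have hk0 : k ≠ 0 := by
    intro h
    apply hA
    rw [hk] at h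
    field_simp at h
    linarith
  have hg : gradient φ z = k • (z - x) := by
    have h := hasGradientAt_quadratic_cone x hz b A c
    rw [hasGradientAt_iff_hasFDerivAt] at h
    have h2 := h.congr_of_eventuallyEq heq
    rw [← hasGradientAt_iff_hasFDerivAt] at h2
    exact h2.gradient
  have hg0 : gradient φ z ≠ 0 := by
    rw [hg]; exact smul_ne_zero hk0 (sub_ne_zero.2 hz)
  have h2 : secondDeriv φ z (k • (z - x)) = -c * (k * ‖z - x‖) ^ 2 := by
    refine secondDeriv_eq_of_line hφ
      (h := fun s => b + A * ((1 + s * k) * ‖z - x‖) - c / 2 * ((1 + s * k) * ‖z - x‖) ^ 2)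
      (h' := fun s => A * (k * ‖z - x‖) - c * ((1 + s * k) * ‖z - x‖) * (k * ‖z - x‖))
      ?_ ?_ ?_
    · have hc : ContinuousAt (fun s : ℝ => z + s • k • (z - x)) 0 := by fun_prop
      have h1 : ∀ᶠ s in 𝓝 (0 : ℝ), 0 < 1 + s * k :=
        (show ContinuousAt (fun s : ℝ => 1 + s * k) 0 by fun_prop).eventually_const_lt
          (by simp)
      have h0 : Tendsto (fun s : ℝ => z + s • k • (z - x)) (𝓝 0) (𝓝 z) := by
        simpa using hc.tendsto
      filter_upwards [h0.eventually heq, h1] with s hs hs1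
      have : z + s • k • (z - x) - x = (1 + s * k) • (z - x) := by
        module
      rw [hs, this, norm_smul, Real.norm_of_nonneg hs1.le]
    · intro s
      have hm : HasDerivAt (fun s : ℝ => (1 + s * k) * ‖z - x‖) (k * ‖z - x‖) s := by
        simpa using (((hasDerivAt_id s).mul_const k).const_add 1).mul_const ‖z - x‖
      refine (((hm.const_mul A).const_add b).sub ((hm.pow 2).const_mul (c / 2))).congr_deriv ?_
      simp only [Nat.cast_ofNat]
      ring
    · have hm : HasDerivAt (fun s : ℝ => (1 + s * k) * ‖z - x‖) (k * ‖z - x‖) 0 := by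
        simpa using (((hasDerivAt_id (0 : ℝ)).mul_const k).const_add 1).mul_const ‖z - x‖
      refine (((hm.const_mul c).mul_const (k * ‖z - x‖)).const_sub
        (A * (k * ‖z - x‖))).congr_deriv ?_
      ring
  rw [laplInfPlus, if_neg hg0, hg, h2, norm_smul, Real.norm_eq_abs, mul_pow, mul_pow, sq_abs]
  field_simp

/-- Comparison from above with quadratic cones. -/
theorem SubPair.le_quadratic_cone {n : ℕ} {U : Set (EuclideanSpace ℝ (Fin n))}
    {u w : EuclideanSpace ℝ (Fin n) → ℝ} (hsub : SubPair U u w) (hu : ContinuousOn u U)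
    {c : ℝ} (hc : ∀ y ∈ U, -c < u y - w y) {x : EuclideanSpace ℝ (Fin n)} {ρ A : ℝ}
    (hball : closedBall x ρ ⊆ U) (hA : ∀ t, 0 < t → t < ρ → A - c * t ≠ 0)
    (hsph : ∀ y ∈ sphere x ρ, u y ≤ u x + A * ρ - c / 2 * ρ ^ 2) :
    ∀ y ∈ closedBall x ρ, u y ≤ u x + A * ‖y - x‖ - c / 2 * ‖y - x‖ ^ 2 := by
  intro y hy
  set f : EuclideanSpace ℝ (Fin n) → ℝ :=
    fun y => u x + A * ‖y - x‖ - c / 2 * ‖y - x‖ ^ 2 with hf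
  have hcont : ContinuousOn (fun y => u y - f y) (closedBall x ρ) :=
    (hu.mono hball).sub (by fun_prop)
  obtain ⟨z, hzB, hzmax⟩ := (isCompact_closedBall x ρ).exists_isMaxOn ⟨y, hy⟩ hcont
  by_contra! hlt
  have hzy : u y - f y ≤ u z - f z := hzmax hy
  have hzpos : 0 < u z - f z := by
    have : f y < u y := hlt
    linarith
  have hzx : z ≠ x := by
    rintro rfl
    simp [hf] at hzpos
  have hzd : ‖z - x‖ < ρ := by
    refine lt_of_le_of_ne (mem_closedBall_iff_norm.1 hzB) fun h => ?_
    have := hsph z (mem_sphere_iff_norm.2 h)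
    simp only [hf, h] at hzpos
    linarith
  obtain ⟨φ, hφ, heq⟩ := exists_contDiff_eventuallyEq_of_ne hzx
    fun y hy => contDiffAt_quadratic_cone x hy (u x) A c
  have hmax : IsLocalMaxOn (fun y => u y - φ y) U z := by
    have hB : closedBall x ρ ∈ 𝓝 z :=
      mem_of_superset (isOpen_ball.mem_nhds (mem_ball_iff_norm.2 hzd)) ball_subset_closedBall
    refine Filter.Eventually.filter_mono nhdsWithin_le_nhds ?_
    filter_upwards [heq, hB] with y hy hyB
    have h1 : u y - f y ≤ u z - f z := hzmax hyB
    have h2 : φ z = f z := heq.self_of_nhds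
    have h3 : φ y = f y := hy
    rw [h2, h3]
    exact h1
  have h1 := hsub φ hφ z (hball hzB) hmax
  rw [laplInfPlus_of_eventuallyEq_quadratic_cone hφ hzx
    (hA _ (norm_pos_iff.2 (sub_ne_zero.2 hzx)) hzd) heq] at h1
  linarith [hc z (hball hzB)]

theorem le_sphMax {n : ℕ} {u : EuclideanSpace ℝ (Fin n) → ℝ} {x y : EuclideanSpace ℝ (Fin n)}
    {ρ : ℝ} (hu : ContinuousOn u (sphere x ρ)) (hy : y ∈ sphere x ρ) : u y ≤ sphMax u x ρ :=
  le_csSup ((isCompact_sphere x ρ).image_of_continuousOn hu).bddAbove (mem_image_of_mem u hy)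

/-- A strict slope bound on a small sphere around `x₀` bounds nearby increments. -/
theorem SubPair.eventually_sub_le {n : ℕ} {U : Set (EuclideanSpace ℝ (Fin n))} (hU : IsOpen U)
    {u w : EuclideanSpace ℝ (Fin n) → ℝ} (hsub : SubPair U u w) (hu : ContinuousOn u U)
    {c : ℝ} (hc0 : 0 < c) (hc : ∀ y ∈ U, -c < u y - w y)
    {x₀ : EuclideanSpace ℝ (Fin n)} (hx₀ : x₀ ∈ U) {S A : ℝ}
    (hS : Tendsto (fun ρ => Splus u x₀ ρ) (𝓝[>] (0 : ℝ)) (𝓝 S)) (hSA : S < A) (hA : A ≠ 0) :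
    ∃ ρ > 0, ∀ᶠ p in 𝓝 x₀, ∀ q ∈ closedBall p ρ, u q - u p ≤ A * ‖q - p‖ := by
  have hid : Tendsto (fun ρ : ℝ => ρ) (𝓝[>] 0) (𝓝 0) := nhdsWithin_le_nhds
  obtain ⟨R, hR, hRU⟩ := Metric.isOpen_iff.1 hU x₀ hx₀
  have e1 : ∀ᶠ ρ in 𝓝[>] (0 : ℝ), Splus u x₀ ρ + c / 2 * ρ < A := by
    refine (hS.add (hid.const_mul (c / 2))).eventually_lt_const ?_
    simpa using hSA
  have e2 : ∀ᶠ ρ in 𝓝[>] (0 : ℝ), c * ρ < |A| := by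
    refine (hid.const_mul c).eventually_lt_const ?_
    simpa using hA
  have e3 : ∀ᶠ ρ in 𝓝[>] (0 : ℝ), 2 * ρ < R := by
    refine (hid.const_mul 2).eventually_lt_const ?_
    simpa using hR
  obtain ⟨ρ, h1, h2, h3, hρ⟩ := (e1.and (e2.and (e3.and self_mem_nhdsWithin))).exists
  have hρ : 0 < ρ := hρ
  have hBU : closedBall x₀ (2 * ρ) ⊆ U := (closedBall_subset_ball h3).trans hRU
  have hsU : sphere x₀ ρ ⊆ U :=
    (sphere_subset_closedBall.trans (closedBall_subset_closedBall (by linarith))).trans hBU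
  set δ := u x₀ + A * ρ - c / 2 * ρ ^ 2 - sphMax u x₀ ρ with hδ
  have hδ0 : 0 < δ := by
    have : Splus u x₀ ρ * ρ = sphMax u x₀ ρ - u x₀ := div_mul_cancel₀ _ hρ.ne'
    nlinarith [mul_lt_mul_of_pos_right h1 hρ]
  have huc := (isCompact_closedBall x₀ (2 * ρ)).uniformContinuousOn_of_continuous (hu.mono hBU)
  obtain ⟨η, hη, hηu⟩ := Metric.uniformContinuousOn_iff.1 huc (δ / 2) (by linarith)
  refine ⟨ρ, hρ, ?_⟩
  filter_upwards [ball_mem_nhds x₀ hη, ball_mem_nhds x₀ hρ] with p hpη hpρ q hq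
  have hpB : closedBall p ρ ⊆ closedBall x₀ (2 * ρ) := by
    refine closedBall_subset_closedBall' ?_
    linarith [mem_ball.1 hpρ]
  have hAρ : ∀ t, 0 < t → t < ρ → A - c * t ≠ 0 := by
    intro t ht htρ h
    have : A = c * t := by linarith
    rw [this, abs_of_pos (by positivity)] at h2
    nlinarith
  have key := hsub.le_quadratic_cone hu hc (hpB.trans hBU) hAρ ?_ q hq
  · have : 0 ≤ c / 2 * ‖q - p‖ ^ 2 := by positivity
    linarith
  · intro y hy
    have hy' : y - p + x₀ ∈ sphere x₀ ρ := by
      simpa [mem_sphere_iff_norm] using mem_sphere_iff_norm.1 hy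
    have ha := le_sphMax (hu.mono hsU) hy'
    have hb := hηu y (hpB (sphere_subset_closedBall hy)) (y - p + x₀)
      (closedBall_subset_closedBall (by linarith) (sphere_subset_closedBall hy')) (by
        rw [dist_eq_norm, show y - (y - p + x₀) = p - x₀ by abel, ← dist_eq_norm]
        exact mem_ball.1 hpη)
    have hd := hηu p (hpB (mem_closedBall_self hρ.le)) x₀
      (mem_closedBall_self (by linarith)) (mem_ball.1 hpη)
    rw [Real.dist_eq, abs_lt] at hb hd
    linarith [hb.2, hd.1]

theorem SubPair.blowup_lipschitz {n : ℕ} (hn : 1 ≤ n)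
    {U : Set (EuclideanSpace ℝ (Fin n))} (hU : IsOpen U)
    {u w : EuclideanSpace ℝ (Fin n) → ℝ} (hsub : SubPair U u w) (hu : ContinuousOn u U)
    {c : ℝ} (hc0 : 0 < c) (hc : ∀ y ∈ U, -c < u y - w y)
    {x₀ : EuclideanSpace ℝ (Fin n)} (hx₀ : x₀ ∈ U)
    {r : ℕ → ℝ} (hrpos : ∀ j, 0 < r j) (hr0 : Tendsto r atTop (𝓝 (0 : ℝ)))
    {v : EuclideanSpace ℝ (Fin n) → ℝ}
    (hconv : ∀ x, Tendsto (fun j => (u (x₀ + r j • x) - u x₀) / r j) atTop (𝓝 (v x)))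
    {S : ℝ} (hS : Tendsto (fun ρ => Splus u x₀ ρ) (𝓝[>] (0 : ℝ)) (𝓝 S)) :
    ∀ x y, |v x - v y| ≤ S * ‖x - y‖ := by
  have hA : ∀ A, S < A → A ≠ 0 → ∀ x y, v y - v x ≤ A * ‖y - x‖ := by
    intro A hSA hA0 x y
    obtain ⟨ρ, hρ, hev⟩ := hsub.eventually_sub_le hU hu hc0 hc hx₀ hS hSA hA0
    have hp : Tendsto (fun j => x₀ + r j • x) atTop (𝓝 x₀) := by
      simpa using (hr0.smul_const x).const_add x₀
    have hd : ∀ᶠ j in atTop, r j * ‖y - x‖ < ρ := by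
      refine (hr0.mul_const ‖y - x‖).eventually_lt_const ?_
      simpa using hρ
    refine le_of_tendsto ((hconv y).sub (hconv x)) ?_
    filter_upwards [hp.eventually hev, hd] with j hj hjd
    have hnorm : ‖x₀ + r j • y - (x₀ + r j • x)‖ = r j * ‖y - x‖ := by
      rw [add_sub_add_left_eq_sub, ← smul_sub, norm_smul, Real.norm_of_nonneg (hrpos j).le]
    have h := hj (x₀ + r j • y) (mem_closedBall_iff_norm.2 (by rw [hnorm]; exact hjd.le))
    rw [hnorm] at h
    rw [← sub_div, div_le_iff₀ (hrpos j)]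
    linarith
  have hS0 : 0 ≤ S := by
    by_contra! hneg
    have : Nonempty (Fin n) := ⟨⟨0, hn⟩⟩
    obtain ⟨e, he⟩ := exists_ne (0 : EuclideanSpace ℝ (Fin n))
    have h1 := hA (S / 2) (by linarith) (by linarith) 0 e
    have h2 := hA (S / 2) (by linarith) (by linarith) e 0
    rw [sub_zero] at h1
    rw [zero_sub, norm_neg] at h2
    nlinarith [norm_pos_iff.2 he]
  have hle : ∀ x y, v y - v x ≤ S * ‖y - x‖ := fun x y => by
    have ht : Tendsto (fun A : ℝ => A * ‖y - x‖) (𝓝[>] S) (𝓝 (S * ‖y - x‖)) :=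
      (tendsto_id.mul_const _).mono_left nhdsWithin_le_nhds
    refine ge_of_tendsto ht ?_
    filter_upwards [self_mem_nhdsWithin] with A hSA
    exact hA A hSA (hS0.trans_lt hSA).ne' x y
  intro x y
  rw [abs_sub_le_iff]
  exact ⟨hle y x, by simpa [norm_sub_rev] using hle x y⟩

/-- Any Lipschitz constant of a blow-up limit is at least the limit slope. -/
theorem slope_le_of_blowup_lipschitz {n : ℕ} (hn : 1 ≤ n)
    {u v : EuclideanSpace ℝ (Fin n) → ℝ} {x₀ : EuclideanSpace ℝ (Fin n)}
    {r : ℕ → ℝ} (hrpos : ∀ j, 0 < r j) (hr0 : Tendsto r atTop (𝓝 (0 : ℝ)))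
    (hconv : ∀ K : Set (EuclideanSpace ℝ (Fin n)), IsCompact K →
      TendstoUniformlyOn (fun j x => (u (x₀ + r j • x) - u x₀) / r j) v atTop K)
    {S : ℝ} (hS : Tendsto (fun ρ => Splus u x₀ ρ) (𝓝[>] (0 : ℝ)) (𝓝 S))
    {L : ℝ} (hL : ∀ x y, |v x - v y| ≤ L * ‖x - y‖) : S ≤ L := by
  have : Nonempty (Fin n) := ⟨⟨0, hn⟩⟩
  have hv0 : v 0 = 0 := by
    refine tendsto_nhds_unique ((hconv {0} isCompact_singleton).tendsto_at rfl) ?_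
    simp
  have hr : Tendsto r atTop (𝓝[>] 0) :=
    tendsto_nhdsWithin_iff.2 ⟨hr0, Eventually.of_forall hrpos⟩
  refine le_of_forall_pos_le_add fun ε hε => le_of_tendsto (hS.comp hr) ?_
  have hu := Metric.tendstoUniformlyOn_iff.1 (hconv _ (isCompact_sphere 0 1)) ε hε
  filter_upwards [hu] with j hj
  have hj0 := hrpos j
  have hmax : sphMax u x₀ (r j) ≤ u x₀ + r j * (L + ε) := by
    refine csSup_le ((NormedSpace.sphere_nonempty.2 hj0.le).image u) ?_
    rintro _ ⟨y, hy, rfl⟩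
    have hx : ‖(r j)⁻¹ • (y - x₀)‖ = 1 := by
      rw [norm_smul, mem_sphere_iff_norm.1 hy, Real.norm_of_nonneg (by positivity)]
      field_simp
    have h1 := hj ((r j)⁻¹ • (y - x₀)) (by simpa using hx)
    have h2 := hL ((r j)⁻¹ • (y - x₀)) 0
    rw [sub_zero, hx, hv0, sub_zero, mul_one] at h2
    rw [smul_inv_smul₀ hj0.ne', add_sub_cancel, Real.dist_eq, abs_sub_comm] at h1
    have h3 : (u y - u x₀) / r j ≤ L + ε := by
      linarith [le_abs_self (v ((r j)⁻¹ • (y - x₀))),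
        le_abs_self ((u y - u x₀) / r j - v ((r j)⁻¹ • (y - x₀)))]
    rw [div_le_iff₀ hj0] at h3
    linarith
  change Splus u x₀ (r j) ≤ L + ε
  rw [Splus, div_le_iff₀ hj0]
  linarith

/-- Lemma 5.7: blow-up limits are Lipschitz with best Lipschitz constant `S_i⁺(x₀)`. -/
theorem blowup_lipschitz_constant {n : ℕ} (hn : 1 ≤ n)
    {U : Set (EuclideanSpace ℝ (Fin n))} (hUo : IsOpen U) (hUb : Bornology.IsBounded U)
    {u₁ u₂ : EuclideanSpace ℝ (Fin n) → ℝ}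
    (hu₁ : ContinuousOn u₁ (closure U)) (hu₂ : ContinuousOn u₂ (closure U))
    (hsol : IsSolution U u₁ u₂)
    {x₀ : EuclideanSpace ℝ (Fin n)} (hx₀ : x₀ ∈ U)
    {r : ℕ → ℝ} (hrpos : ∀ j, 0 < r j) (hr0 : Tendsto r atTop (𝓝 (0:ℝ)))
    {v₁ v₂ : EuclideanSpace ℝ (Fin n) → ℝ}
    (hconv₁ : ∀ K : Set (EuclideanSpace ℝ (Fin n)), IsCompact K →
      (∀ᶠ j in atTop, ∀ x ∈ K, x₀ + r j • x ∈ U) ∧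
      TendstoUniformlyOn (fun j x => (u₁ (x₀ + r j • x) - u₁ x₀) / r j) v₁ atTop K)
    (hconv₂ : ∀ K : Set (EuclideanSpace ℝ (Fin n)), IsCompact K →
      (∀ᶠ j in atTop, ∀ x ∈ K, x₀ + r j • x ∈ U) ∧
      TendstoUniformlyOn (fun j x => (u₂ (x₀ + r j • x) - u₂ x₀) / r j) v₂ atTop K)
    {S₁ S₂ : ℝ}
    (hS₁ : Tendsto (fun ρ => Splus u₁ x₀ ρ) (𝓝[>] (0:ℝ)) (𝓝 S₁))
    (hS₂ : Tendsto (fun ρ => Splus u₂ x₀ ρ) (𝓝[>] (0:ℝ)) (𝓝 S₂)) :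
    ((∀ x y, |v₁ x - v₁ y| ≤ S₁ * ‖x - y‖) ∧
      ∀ L : ℝ, 0 ≤ L → (∀ x y, |v₁ x - v₁ y| ≤ L * ‖x - y‖) → S₁ ≤ L) ∧
    ((∀ x y, |v₂ x - v₂ y| ≤ S₂ * ‖x - y‖) ∧
      ∀ L : ℝ, 0 ≤ L → (∀ x y, |v₂ x - v₂ y| ≤ L * ‖x - y‖) → S₂ ≤ L) := by
  obtain ⟨c, hc⟩ := (hUb.isCompact_closure).exists_bound_of_continuousOn (hu₁.sub hu₂)
  have hc' : ∀ y ∈ U, |u₁ y - u₂ y| < |c| + 1 := fun y hy =>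
    lt_of_le_of_lt (hc y (subset_closure hy)) (by linarith [le_abs_self c])
  have hc0 : 0 < |c| + 1 := by positivity
  have hpt : ∀ {u v : EuclideanSpace ℝ (Fin n) → ℝ},
      (∀ K : Set (EuclideanSpace ℝ (Fin n)), IsCompact K →
        TendstoUniformlyOn (fun j x => (u (x₀ + r j • x) - u x₀) / r j) v atTop K) →
      ∀ x, Tendsto (fun j => (u (x₀ + r j • x) - u x₀) / r j) atTop (𝓝 (v x)) :=
    fun h x => (h {x} isCompact_singleton).tendsto_at rfl
  have hK₁ := fun K hK => (hconv₁ K hK).2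
  have hK₂ := fun K hK => (hconv₂ K hK).2
  obtain ⟨⟨-, -, hsub₁, hsub₂⟩, -⟩ := hsol
  refine ⟨⟨?_, fun L _ hL => slope_le_of_blowup_lipschitz hn hrpos hr0 hK₁ hS₁ hL⟩,
    ⟨?_, fun L _ hL => slope_le_of_blowup_lipschitz hn hrpos hr0 hK₂ hS₂ hL⟩⟩
  · exact hsub₁.blowup_lipschitz hn hUo (hu₁.mono subset_closure) hc0
      (fun y hy => (abs_lt.1 (hc' y hy)).1) hx₀ hrpos hr0 (hpt hK₁) hS₁
  · exact hsub₂.blowup_lipschitz hn hUo (hu₂.mono subset_closure) hc0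
      (fun y hy => by linarith [(abs_lt.1 (hc' y hy)).2]) hx₀ hrpos hr0 (hpt hK₂) hS₂
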